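/- arXiv:1707.00401 — 2 statements merged into one kernel-verified Lean document; each statement's English description precedes it below -/
import Mathlib

section
/- Spectrum of D^{−01}: Let D be a simple r-regular digraph on n ≥ 1 vertices with adjacency matrix A : Matrix (Fin n) (Fin n) ℝ (every entry 0 or 1, zero diagonal, all row and column sums equal to r ≥ 1) and m = n·r arcs. Let M = fromBlocks (J − I − A) J_{n,m} J_{m,n} 0 (the adjacency matrix of the transformation D^{−01}, which has the complement of D among the vertices, no arcs among the arc-vertices, and all arcs between the two parts in both directions). Then for every λ ∈ ℝ: (λ + 1 + r) · det(λ·I_{n+m} − M) = (−1)^n · λ^{m−1} · (λ·(λ + 1 + r − n) − m·n) · det((−λ − 1)·I_n − A). -/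
open Matrix

lemma aux_rank_one (n : ℕ) (hn : 1 ≤ n) (B J : Matrix (Fin n) (Fin n) ℝ) (s c : ℝ)
    (hB : ∀ i, ∑ j, B i j = s) (hJ : ∀ i j, J i j = 1) :
    s * (B - c • J).det = (s - c * n) * B.det := by
  by_cases hs : s = 0
  · have h0 : B.det = 0 := by
      apply Matrix.exists_mulVec_eq_zero_iff.mp
      refine ⟨fun _ => 1, ?_, ?_⟩
      · intro h
        have := congrFun h ⟨0, hn⟩
        simp at this
      · ext i
        simp [Matrix.mulVec, dotProduct, hB, hs]
    simp [hs, h0]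
  · have h1 : B - c • J = B * (1 - (c / s) • J) := by
      rw [Matrix.mul_sub, Matrix.mul_one]
      congr 1
      ext i j
      simp only [Matrix.smul_apply, Matrix.mul_apply, hJ, smul_eq_mul, mul_one]
      rw [← Finset.sum_mul, hB]
      field_simp
    have h2 : (1 - (c / s) • J).det = 1 - c / s * n := by
      have h3 : (1 - (c / s) • J) = 1 - (Matrix.of fun (_ : Fin n) (_ : Unit) => c / s) *
          (Matrix.of fun (_ : Unit) (_ : Fin n) => (1 : ℝ)) := by
        congr 1
        ext i j
        simp [Matrix.mul_apply, hJ]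
      rw [h3, Matrix.det_one_sub_mul_comm]
      simp [Matrix.mul_apply]
      ring
    rw [h1, Matrix.det_mul, h2]
    field_simp

/-- Spectrum of the transformation `D^{-01}` of a simple `r`-regular digraph. -/
theorem spectrum_minus_zero_one (n r m : ℕ) (hn : 1 ≤ n) (hr : 1 ≤ r) (hm : m = n * r)
    (A J : Matrix (Fin n) (Fin n) ℝ)
    (hA01 : ∀ i j, A i j = 0 ∨ A i j = 1)
    (hAdiag : ∀ i, A i i = 0)
    (hrow : ∀ i, ∑ j, A i j = (r : ℝ))
    (hcol : ∀ j, ∑ i, A i j = (r : ℝ))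
    (hJ : ∀ i j, J i j = 1)
    (Jnm : Matrix (Fin n) (Fin m) ℝ) (hJnm : ∀ i e, Jnm i e = 1)
    (Jmn : Matrix (Fin m) (Fin n) ℝ) (hJmn : ∀ e i, Jmn e i = 1)
    (lam : ℝ) :
    (lam + 1 + (r : ℝ)) *
        (lam • (1 : Matrix (Fin n ⊕ Fin m) (Fin n ⊕ Fin m) ℝ)
          - Matrix.fromBlocks (J - 1 - A) Jnm Jmn 0).det
      = (-1 : ℝ) ^ n * lam ^ (m - 1) *
          (lam * (lam + 1 + (r : ℝ) - (n : ℝ)) - (m : ℝ) * (n : ℝ)) *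
        ((-lam - 1) • (1 : Matrix (Fin n) (Fin n) ℝ) - A).det := by
  have hm1 : 1 ≤ m := by rw [hm]; exact Nat.mul_pos hn hr
  have key : ∀ x : ℝ, x ≠ 0 → (x + 1 + (r : ℝ)) *
        (x • (1 : Matrix (Fin n ⊕ Fin m) (Fin n ⊕ Fin m) ℝ)
          - Matrix.fromBlocks (J - 1 - A) Jnm Jmn 0).det
      = (-1 : ℝ) ^ n * x ^ (m - 1) *
          (x * (x + 1 + (r : ℝ) - (n : ℝ)) - (m : ℝ) * (n : ℝ)) *
        ((-x - 1) • (1 : Matrix (Fin n) (Fin n) ℝ) - A).det := by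
    intro x hx
    have hblk : x • (1 : Matrix (Fin n ⊕ Fin m) (Fin n ⊕ Fin m) ℝ)
          - Matrix.fromBlocks (J - 1 - A) Jnm Jmn 0
        = Matrix.fromBlocks ((x + 1) • (1 : Matrix (Fin n) (Fin n) ℝ) + A - J) (-Jnm) (-Jmn)
          (x • (1 : Matrix (Fin m) (Fin m) ℝ)) := by
      rw [← Matrix.fromBlocks_one, Matrix.fromBlocks_smul, sub_eq_add_neg, Matrix.fromBlocks_neg,
        Matrix.fromBlocks_add]
      congr 1
      · rw [add_smul, one_smul]; abel
      · simp
      · simp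
      · simp
    let _ : Invertible (x • (1 : Matrix (Fin m) (Fin m) ℝ)) :=
      ⟨x⁻¹ • 1, by simp [smul_smul, hx], by simp [smul_smul, hx]⟩
    have hinv : ⅟(x • (1 : Matrix (Fin m) (Fin m) ℝ)) = x⁻¹ • 1 := rfl
    have hschur : (x + 1) • (1 : Matrix (Fin n) (Fin n) ℝ) + A - J
          - (-Jnm) * ⅟(x • (1 : Matrix (Fin m) (Fin m) ℝ)) * (-Jmn)
        = ((x + 1) • (1 : Matrix (Fin n) (Fin n) ℝ) + A) - (1 + m / x) • J := by
      rw [hinv, add_smul 1 ((m : ℝ) / x) J, one_smul, ← sub_sub]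
      congr 1
      ext i j
      simp [Matrix.mul_apply, hJ, hJnm, hJmn]
      field_simp
    have hB : ∀ i, ∑ j, ((x + 1) • (1 : Matrix (Fin n) (Fin n) ℝ) + A) i j = x + 1 + r := by
      intro i
      simp only [Matrix.add_apply, Finset.sum_add_distrib, hrow, Matrix.smul_apply,
        smul_eq_mul, ← Finset.mul_sum, Matrix.one_apply]
      simp
    have hneg : ((-x - 1) • (1 : Matrix (Fin n) (Fin n) ℝ) - A)
        = -((x + 1) • (1 : Matrix (Fin n) (Fin n) ℝ) + A) := by
      rw [neg_add, ← neg_smul, sub_eq_add_neg, neg_add', sub_eq_add_neg]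
    have hpow : x ^ m = x ^ (m - 1) * x := by
      rw [← pow_succ, Nat.sub_add_cancel hm1]
    have hone : ((-1 : ℝ) ^ n) * (-1) ^ n = 1 := by
      rw [← mul_pow]; simp
    have haux := aux_rank_one n hn _ J _ (1 + m / x) hB hJ
    rw [hblk, Matrix.det_fromBlocks₂₂, hschur, hneg, Matrix.det_neg, Matrix.det_smul,
      Matrix.det_one, Fintype.card_fin, Fintype.card_fin, mul_one, mul_left_comm, haux, hpow]
    generalize ((x + 1) • (1 : Matrix (Fin n) (Fin n) ℝ) + A).det = d
    have hx2 : x * (x + 1 + r - (1 + m / x) * n) = x * (x + 1 + r - n) - m * n := by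
      field_simp
      ring
    rw [← hx2]
    linear_combination (-(x ^ (m - 1) * (x * (x + 1 + r - (1 + m / x) * n)) * d)) * hone
  have hfun := Continuous.ext_on (dense_compl_singleton (0 : ℝ))
    (f := fun x : ℝ => (x + 1 + (r : ℝ)) *
        (x • (1 : Matrix (Fin n ⊕ Fin m) (Fin n ⊕ Fin m) ℝ)
          - Matrix.fromBlocks (J - 1 - A) Jnm Jmn 0).det)
    (g := fun x : ℝ => (-1 : ℝ) ^ n * x ^ (m - 1) *
          (x * (x + 1 + (r : ℝ) - (n : ℝ)) - (m : ℝ) * (n : ℝ)) *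
        ((-x - 1) • (1 : Matrix (Fin n) (Fin n) ℝ) - A).det)
    (by
      refine Continuous.mul (by fun_prop) (Continuous.matrix_det (by fun_prop)))
    (by
      refine Continuous.mul (by fun_prop) (Continuous.matrix_det (by fun_prop)))
    (fun x hx => key x hx)
  exact congrFun hfun lam
end

section
/- Spectrum of D^{00−}: Let D be an r-regular digraph (loops and multiple arcs allowed) with n ≥ 1 vertices and m = n·r arcs (r ≥ 1), encoded by incidence matrices T, H : Matrix (Fin n) (Fin m) ℝ. Let M = fromBlocks 0 (J_{n,m} − T) (J_{m,n} − Hᵀ) 0 (the adjacency matrix of the transformation D^{00−}: no arcs among the vertices or among the arc-vertices, an arc v→e exactly when v is NOT the tail of e, and an arc e→v exactly when v is NOT the head of e). Then for every λ ∈ ℝ: (λ² − r) · det(λ·I_{n+m} − M) = λ^{m−n} · (λ² − r + 2·m − m·n) · det(λ²·I_n − T * Hᵀ). -/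
open Matrix

theorem aux_det (n : ℕ) (hn : 1 ≤ n) (B : Matrix (Fin n) (Fin n) ℝ) (y c : ℝ)
    (hB : ∀ i, ∑ j, B i j = y) :
    y * (B - c • Matrix.of (fun _ _ => (1 : ℝ))).det = (y - c * n) * B.det := by
  by_cases hy : y = 0
  · subst hy
    have hz : B.det = 0 := by
      apply Matrix.exists_mulVec_eq_zero_iff.mp
      refine ⟨fun _ => 1, ?_, ?_⟩
      · intro h
        have := congrFun h ⟨0, hn⟩
        simp at this
      · ext i
        simp [Matrix.mulVec, dotProduct, hB]
    simp [hz]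
  · have e : B - c • Matrix.of (fun _ _ => (1 : ℝ)) =
        B * (1 + Matrix.replicateCol Unit (fun _ : Fin n => (-(c / y) : ℝ)) *
          Matrix.replicateRow Unit (fun _ : Fin n => (1 : ℝ))) := by
      rw [Matrix.mul_add, Matrix.mul_one]
      ext i j
      simp only [Matrix.sub_apply, Matrix.add_apply, Matrix.smul_apply, Matrix.of_apply,
        Matrix.mul_apply, Matrix.replicateCol_apply, Matrix.replicateRow_apply]
      simp only [Finset.univ_unique, Finset.sum_const, Finset.card_singleton, one_smul, mul_one,
        ← Finset.sum_mul, hB, smul_eq_mul]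
      field_simp
      ring
    rw [e, Matrix.det_mul, Matrix.det_one_add_replicateCol_mul_replicateRow]
    simp [dotProduct]
    field_simp
    ring

/-- Spectrum of the transformation `D^{00-}` of an `r`-regular general digraph. -/
theorem spectrum_zero_zero_minus (n r m : ℕ) (hn : 1 ≤ n) (hr : 1 ≤ r) (hm : m = n * r)
    (T H : Matrix (Fin n) (Fin m) ℝ)
    (hT01 : ∀ i e, T i e = 0 ∨ T i e = 1)
    (hH01 : ∀ i e, H i e = 0 ∨ H i e = 1)
    (hTcol : ∀ e, ∑ i, T i e = 1)
    (hHcol : ∀ e, ∑ i, H i e = 1)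
    (hTrow : ∀ i, ∑ e, T i e = (r : ℝ))
    (hHrow : ∀ i, ∑ e, H i e = (r : ℝ))
    (Jnm : Matrix (Fin n) (Fin m) ℝ) (hJnm : ∀ i e, Jnm i e = 1)
    (Jmn : Matrix (Fin m) (Fin n) ℝ) (hJmn : ∀ e i, Jmn e i = 1)
    (lam : ℝ) :
    (lam ^ 2 - (r : ℝ)) *
        (lam • (1 : Matrix (Fin n ⊕ Fin m) (Fin n ⊕ Fin m) ℝ)
          - Matrix.fromBlocks 0 (Jnm - T) (Jmn - Hᵀ) 0).det
      = lam ^ (m - n) * (lam ^ 2 - (r : ℝ) + 2 * (m : ℝ) - (m : ℝ) * (n : ℝ)) *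
        ((lam ^ 2) • (1 : Matrix (Fin n) (Fin n) ℝ) - T * Hᵀ).det := by
  have hnm : n ≤ m := by
    rw [hm]; exact Nat.le_mul_of_pos_right n hr
  have hPQ : (Jnm - T) * (Jmn - Hᵀ) =
      T * Hᵀ + ((m : ℝ) - 2 * r) • Matrix.of (fun _ _ => (1 : ℝ)) := by
    ext i j
    simp only [Matrix.mul_apply, Matrix.sub_apply, Matrix.add_apply, Matrix.smul_apply,
      Matrix.of_apply, Matrix.transpose_apply, hJnm, hJmn, smul_eq_mul]
    have : ∀ e, (1 - T i e) * (1 - H j e) = 1 - T i e - H j e + T i e * H j e := by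
      intro e; ring
    simp only [this, Finset.sum_add_distrib, Finset.sum_sub_distrib, hTrow, hHrow]
    simp
    ring
  have hrow : ∀ (x : ℝ) i, ∑ j, (x • (1 : Matrix (Fin n) (Fin n) ℝ) - T * Hᵀ) i j = x - r := by
    intro x i
    simp only [Matrix.sub_apply, Matrix.smul_apply, Finset.sum_sub_distrib, Matrix.mul_apply,
      Matrix.transpose_apply]
    rw [Finset.sum_comm]
    simp only [← Finset.mul_sum, hHcol, mul_one, hTrow, smul_eq_mul]
    simp [Matrix.one_apply]
  have key : ∀ l : ℝ, l ≠ 0 → (l ^ 2 - (r : ℝ)) *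
        (l • (1 : Matrix (Fin n ⊕ Fin m) (Fin n ⊕ Fin m) ℝ)
          - Matrix.fromBlocks 0 (Jnm - T) (Jmn - Hᵀ) 0).det
      = l ^ (m - n) * (l ^ 2 - (r : ℝ) + 2 * (m : ℝ) - (m : ℝ) * (n : ℝ)) *
        ((l ^ 2) • (1 : Matrix (Fin n) (Fin n) ℝ) - T * Hᵀ).det := by
    intro l hl
    have hM : l • (1 : Matrix (Fin n ⊕ Fin m) (Fin n ⊕ Fin m) ℝ)
          - Matrix.fromBlocks 0 (Jnm - T) (Jmn - Hᵀ) 0 =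
        Matrix.fromBlocks (l • 1) (-(Jnm - T)) (-(Jmn - Hᵀ)) (l • 1) := by
      rw [← Matrix.fromBlocks_one, Matrix.fromBlocks_smul, sub_eq_add_neg,
        Matrix.fromBlocks_neg, Matrix.fromBlocks_add]
      simp
    let _ : Invertible (l • (1 : Matrix (Fin m) (Fin m) ℝ)) :=
      ⟨l⁻¹ • 1, by simp [hl], by simp [hl]⟩
    have hinv : ⅟(l • (1 : Matrix (Fin m) (Fin m) ℝ)) = l⁻¹ • 1 := rfl
    have hS : l ^ n * (l • (1 : Matrix (Fin n) (Fin n) ℝ) -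
        l⁻¹ • ((Jnm - T) * (Jmn - Hᵀ))).det =
        (l ^ 2 • (1 : Matrix (Fin n) (Fin n) ℝ) - (Jnm - T) * (Jmn - Hᵀ)).det := by
      have := Matrix.det_smul (l • (1 : Matrix (Fin n) (Fin n) ℝ) -
        l⁻¹ • ((Jnm - T) * (Jmn - Hᵀ))) l
      rw [Fintype.card_fin] at this
      rw [← this, smul_sub, smul_smul, smul_smul, mul_inv_cancel₀ hl, one_smul, sq]
    have hdet : (Matrix.fromBlocks (l • 1) (-(Jnm - T)) (-(Jmn - Hᵀ)) (l • 1)).det =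
        l ^ (m - n) * (l ^ 2 • (1 : Matrix (Fin n) (Fin n) ℝ) - (Jnm - T) * (Jmn - Hᵀ)).det := by
      rw [Matrix.det_fromBlocks₂₂, hinv, ← hS, ← mul_assoc, ← pow_add, Nat.sub_add_cancel hnm,
        Matrix.det_smul, Matrix.det_one, Fintype.card_fin, mul_one, Matrix.mul_smul,
        Matrix.mul_one, Matrix.smul_mul, Matrix.neg_mul, Matrix.mul_neg, smul_neg, smul_neg, neg_neg]
    have ha := aux_det n hn _ _ ((m : ℝ) - 2 * r) (hrow (l ^ 2))
    rw [hM, hdet, hPQ, ← sub_sub, mul_left_comm, ha, mul_assoc]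
    have hm' : (m : ℝ) = n * r := by exact_mod_cast hm
    rw [hm']
    ring
  have hc := Continuous.ext_on (dense_compl_singleton (0 : ℝ)) (f := fun l : ℝ =>
      (l ^ 2 - (r : ℝ)) *
        (l • (1 : Matrix (Fin n ⊕ Fin m) (Fin n ⊕ Fin m) ℝ)
          - Matrix.fromBlocks 0 (Jnm - T) (Jmn - Hᵀ) 0).det)
    (g := fun l : ℝ => l ^ (m - n) * (l ^ 2 - (r : ℝ) + 2 * (m : ℝ) - (m : ℝ) * (n : ℝ)) *
        ((l ^ 2) • (1 : Matrix (Fin n) (Fin n) ℝ) - T * Hᵀ).det)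
    (by
      refine Continuous.mul (by fun_prop) (Continuous.matrix_det ?_)
      fun_prop)
    (by
      refine Continuous.mul (by fun_prop) (Continuous.matrix_det ?_)
      fun_prop)
    (fun l hl => key l hl)
  exact congrFun hc lam
end
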